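/- Let M and N be two n×n complex hermitian matrices with empirical distribution functions F_M and F_N. Then sup_{x∈ℝ} |F_M(x) − F_N(x)| ≤ (1/n)·rank(M − N). -/

import Mathlib

/-- The empirical distribution function of a hermitian matrix:
`F_M(x) = (1/n) · #{eigenvalues of M (with multiplicity) that are ≤ x}`
(junk value 0 if the matrix is not hermitian). -/
noncomputable def edf {n : ℕ} (M : Matrix (Fin n) (Fin n) ℂ) (x : ℝ) : ℝ :=
  if h : M.IsHermitian then
    ((Finset.univ.filter fun i => h.eigenvalues i ≤ x).card : ℝ) / n
  else 0

lemma Matrix.rank_neg {m n R : Type*} [Fintype n] [CommRing R] (A : Matrix m n R) :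
    (-A).rank = A.rank := by
  rw [← neg_one_smul R A]
  exact A.rank_smul_of_mem_nonZeroDivisors isUnit_one.neg.mem_nonZeroDivisors

open scoped InnerProductSpace in
/-- The quadratic form of a hermitian matrix in coordinates of its eigenvector basis. -/
lemma Matrix.IsHermitian.re_inner_toEuclideanLin_eq_sum {n : Type*} [Fintype n] [DecidableEq n]
    {A : Matrix n n ℂ} (hA : A.IsHermitian) (v : EuclideanSpace ℂ n) :
    (⟪v, A.toEuclideanLin v⟫_ℂ).re =
      ∑ i, hA.eigenvalues i * ‖⟪hA.eigenvectorBasis i, v⟫_ℂ‖ ^ 2 := by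
  rw [← hA.eigenvectorBasis.sum_inner_mul_inner, Complex.re_sum]
  refine Finset.sum_congr rfl fun i _ => ?_
  have hsymm := Matrix.isSymmetric_toEuclideanLin_iff.mpr hA
  have heig : A.toEuclideanLin (hA.eigenvectorBasis i) =
      (hA.eigenvalues i : ℂ) • hA.eigenvectorBasis i := by
    ext j
    simpa using congrFun (hA.mulVec_eigenvectorBasis i) j
  rw [← hsymm, heig, inner_smul_left, Complex.conj_ofReal, mul_left_comm,
    ← inner_conj_symm v, Complex.conj_mul', ← Complex.ofReal_pow, ← Complex.ofReal_mul,
    Complex.ofReal_re]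

open scoped InnerProductSpace in
/-- Subtracting a matrix of rank `r` from a hermitian matrix lowers the number of eigenvalues
below a threshold by at most `r`. -/
lemma Matrix.IsHermitian.card_eigenvalues_le_le_add_rank {n : Type*} [Fintype n] [DecidableEq n]
    {A B : Matrix n n ℂ} (hA : A.IsHermitian) (hB : B.IsHermitian) (x : ℝ) :
    (Finset.univ.filter fun i => hA.eigenvalues i ≤ x).card ≤
      (Finset.univ.filter fun i => hB.eigenvalues i ≤ x).card + (A - B).rank := by
  let a := hA.eigenvectorBasis
  let b := hB.eigenvectorBasis
  let Φ : EuclideanSpace ℂ n →ₗ[ℂ]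
      ({i // ¬ hA.eigenvalues i ≤ x} → ℂ) × ({i // hB.eigenvalues i ≤ x} → ℂ) ×
        LinearMap.range (A - B).toEuclideanLin :=
    (LinearMap.pi fun i => (innerSL ℂ (a i.1)).toLinearMap).prod
      ((LinearMap.pi fun i => (innerSL ℂ (b i.1)).toLinearMap).prod
        (A - B).toEuclideanLin.rangeRestrict)
  have hΦ : Function.Injective Φ := by
    rw [injective_iff_map_eq_zero]
    intro v hv
    have h1 : ∀ i, ¬ hA.eigenvalues i ≤ x → ⟪a i, v⟫_ℂ = 0 := fun i hi =>
      congrFun (congrArg Prod.fst hv) ⟨i, hi⟩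
    have h2 : ∀ i, hB.eigenvalues i ≤ x → ⟪b i, v⟫_ℂ = 0 := fun i hi =>
      congrFun (congrArg (fun p => p.2.1) hv) ⟨i, hi⟩
    have h3 : (A - B).toEuclideanLin v = 0 :=
      congrArg (fun p => (p.2.2 : EuclideanSpace ℂ n)) hv
    have h4 : A.toEuclideanLin v = B.toEuclideanLin v := by
      rwa [map_sub, LinearMap.sub_apply, sub_eq_zero] at h3
    have hle : ∑ i, hB.eigenvalues i * ‖⟪b i, v⟫_ℂ‖ ^ 2 ≤ ∑ i, x * ‖⟪b i, v⟫_ℂ‖ ^ 2 := by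
      rw [← hB.re_inner_toEuclideanLin_eq_sum, ← h4, hA.re_inner_toEuclideanLin_eq_sum,
        ← Finset.mul_sum, b.sum_sq_norm_inner_right, ← a.sum_sq_norm_inner_right, Finset.mul_sum]
      refine Finset.sum_le_sum fun i _ => ?_
      by_cases hi : hA.eigenvalues i ≤ x
      · gcongr
      · change _ * ‖⟪a i, v⟫_ℂ‖ ^ 2 ≤ _ * ‖⟪a i, v⟫_ℂ‖ ^ 2
        simp [h1 i hi]
    have hterm : ∀ i ∈ Finset.univ,
        x * ‖⟪b i, v⟫_ℂ‖ ^ 2 ≤ hB.eigenvalues i * ‖⟪b i, v⟫_ℂ‖ ^ 2 := by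
      intro i _
      by_cases hi : hB.eigenvalues i ≤ x
      · simp [h2 i hi]
      · gcongr
        exact (not_le.mp hi).le
    have heq := (Finset.sum_eq_sum_iff_of_le hterm).mp (le_antisymm (Finset.sum_le_sum hterm) hle)
    refine InnerProductSpace.ext_inner_left_basis b.toBasis fun i => ?_
    rw [b.coe_toBasis, inner_zero_right]
    by_cases hi : hB.eigenvalues i ≤ x
    · exact h2 i hi
    · have := heq i (Finset.mem_univ i)
      by_contra hne
      have hpos : 0 < ‖⟪b i, v⟫_ℂ‖ ^ 2 := by positivity
      exact hi (mul_right_cancel₀ hpos.ne' this).ge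
  have hdim := LinearMap.finrank_le_finrank_of_injective hΦ
  rw [Module.finrank_prod, Module.finrank_prod, Module.finrank_fintype_fun_eq_card,
    Module.finrank_fintype_fun_eq_card, finrank_euclideanSpace,
    Fintype.card_subtype_compl, Matrix.toEuclideanLin_eq_toLin_orthonormal,
    ← Matrix.rank_eq_finrank_range_toLin] at hdim
  have hcard := Fintype.card_subtype_le fun i => hA.eigenvalues i ≤ x
  rw [← Fintype.card_subtype, ← Fintype.card_subtype]
  omega

theorem bai_rank_inequality {n : ℕ} (M N : Matrix (Fin n) (Fin n) ℂ)
    (hM : M.IsHermitian) (hN : N.IsHermitian) :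
    ∀ x : ℝ, |edf M x - edf N x| ≤ ((M - N).rank : ℝ) / n := by
  intro x
  have h1 := hM.card_eigenvalues_le_le_add_rank hN x
  have h2 := hN.card_eigenvalues_le_le_add_rank hM x
  rw [← neg_sub, Matrix.rank_neg] at h2
  rify at h1 h2
  rw [edf, edf, dif_pos hM, dif_pos hN, ← sub_div, abs_div, Nat.abs_cast]
  gcongr
  rw [abs_sub_le_iff]
  constructor <;> linarith
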